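/- arXiv:1104.2080 — 2 statements merged into one kernel-verified Lean document; each statement's English description precedes it below -/
import Mathlib

section
/- For every n ∈ (0,1], β > 0 and h ∈ ℝ, the function N ↦ ψ_N(n,β,h) := n^{−1} log E[Z_N(β,h;J)^n] is superadditive: ψ_{N₁+N₂}(n,β,h) ≥ ψ_{N₁}(n,β,h) + ψ_{N₂}(n,β,h) for all N₁, N₂ ≥ 1. Consequently the limit lim_{N→∞} φ_N(n,β,h) exists, is finite, and equals sup_{N≥1} φ_N(n,β,h) =: φ(n,β,h). -/
open MeasureTheory ProbabilityTheory Real Filter Topology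

noncomputable section

/-- The ±1 spin value attached to a Boolean. -/
def spinVal (b : Bool) : ℝ := if b then 1 else -1

/-- Law of the couplings `J = (J_{ij})`: i.i.d. standard Gaussians. -/
def skMuJ (N : ℕ) : Measure (Fin N × Fin N → ℝ) :=
  Measure.pi fun _ => gaussianReal 0 1

/-- The Sherrington–Kirkpatrick Hamiltonian. -/
def skH (N : ℕ) (h : ℝ) (J : Fin N × Fin N → ℝ) (σ : Fin N → Bool) : ℝ :=
  -(1 / Real.sqrt (N : ℝ)) *
      ∑ p ∈ Finset.univ.filter (fun p : Fin N × Fin N => p.1 < p.2),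
        J p * spinVal (σ p.1) * spinVal (σ p.2)
    - h * ∑ i, spinVal (σ i)

/-- The SK partition function. -/
def skZ (N : ℕ) (β h : ℝ) (J : Fin N × Fin N → ℝ) : ℝ :=
  ∑ σ : Fin N → Bool, Real.exp (-β * skH N h J σ)

/-- Quenched pressure `α_N(β,h) = N⁻¹ E log Z_N`. -/
def skAlpha (N : ℕ) (β h : ℝ) : ℝ :=
  (1 / (N : ℝ)) * ∫ J, Real.log (skZ N β h J) ∂ skMuJ N

/-- Interpolating function `φ_N(n,β,h) = (Nn)⁻¹ log E[Z_N^n]`. -/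
def skPhi (N : ℕ) (n β h : ℝ) : ℝ :=
  (1 / ((N : ℝ) * n)) * Real.log (∫ J, skZ N β h J ^ n ∂ skMuJ N)

/-- `ψ_N(n,β,h) = n⁻¹ log E[Z_N^n]`. -/
def skPsi (N : ℕ) (n β h : ℝ) : ℝ :=
  n⁻¹ * Real.log (∫ J, skZ N β h J ^ n ∂ skMuJ N)

/-- The law of a finite family of independent standard Gaussians. -/
abbrev piGaussian (ι : Type*) [Fintype ι] : Measure (ι → ℝ) :=
  Measure.pi fun _ => gaussianReal 0 1

/-- Gaussian integration by parts on the line. -/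
theorem integral_id_mul_gaussianReal {g g' : ℝ → ℝ} (hg : ∀ x, HasDerivAt g (g' x) x)
    (hi : Integrable g (gaussianReal 0 1)) (hi' : Integrable g' (gaussianReal 0 1))
    (hxi : Integrable (fun x => x * g x) (gaussianReal 0 1)) :
    ∫ x, x * g x ∂gaussianReal 0 1 = ∫ x, g' x ∂gaussianReal 0 1 := by
  have key : ∀ f : ℝ → ℝ, Integrable f (gaussianReal 0 1) →
      Integrable (fun x => f x * gaussianPDFReal 0 1 x) := by
    intro f hf
    rw [gaussianReal_of_var_ne_zero 0 one_ne_zero,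
      integrable_withDensity_iff_integrable_smul' (measurable_gaussianPDF 0 1)
        (ae_of_all _ fun x => gaussianPDF_lt_top)] at hf
    simpa [toReal_gaussianPDF, mul_comm] using hf
  have hd : ∀ x, HasDerivAt (gaussianPDFReal 0 1) (-(x * gaussianPDFReal 0 1 x)) x := by
    intro x
    have h1 : HasDerivAt (fun y : ℝ => -(y - 0) ^ 2 / (2 * ((1 : NNReal) : ℝ))) (-x) x := by
      have := (((hasDerivAt_id x).sub_const 0).pow 2).neg.div_const (2 * ((1 : NNReal) : ℝ))
      refine this.congr_deriv ?_
      simp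
      ring
    refine (h1.exp.const_mul (√(2 * π * (1 : NNReal)))⁻¹).congr_deriv ?_
    rw [gaussianPDFReal]
    ring
  have hibp := integral_mul_deriv_eq_deriv_mul_of_integrable (u := g) (u' := g')
    (fun x _ => hg x) (fun x _ => hd x)
    (((key _ hxi).neg).congr (ae_of_all _ fun x => by simp; ring))
    (key _ hi') (key _ hi)
  rw [integral_gaussianReal_eq_integral_smul one_ne_zero,
    integral_gaussianReal_eq_integral_smul one_ne_zero]
  simp only [smul_eq_mul]
  calc ∫ x, gaussianPDFReal 0 1 x * (x * g x)
      = -∫ x, g x * -(x * gaussianPDFReal 0 1 x) := by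
        rw [← integral_neg]; congr 1; ext x; ring
    _ = _ := by rw [hibp, neg_neg]; simp only [mul_comm]

/-- Resampling one coordinate preserves a product of probability measures. -/
theorem measurePreserving_update {ι : Type*} [Fintype ι] [DecidableEq ι] {α : ι → Type*}
    [∀ i, MeasurableSpace (α i)] (μ : ∀ i, Measure (α i)) [∀ i, IsProbabilityMeasure (μ i)]
    (k : ι) :
    MeasurePreserving (fun p : α k × (∀ i, α i) => Function.update p.2 k p.1)
      ((μ k).prod (Measure.pi μ)) (Measure.pi μ) := by
  have hm : Measurable (fun p : α k × (∀ i, α i) => Function.update p.2 k p.1) := by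
    refine measurable_pi_iff.2 fun i => ?_
    by_cases hik : i = k
    · subst hik
      simpa using measurable_fst
    · simp only [Function.update_of_ne hik]
      fun_prop
  refine ⟨hm, (Measure.pi_eq fun s hs => ?_).symm⟩
  rw [Measure.map_apply hm (MeasurableSet.univ_pi hs)]
  have : (fun p : α k × (∀ i, α i) => Function.update p.2 k p.1) ⁻¹' (Set.univ.pi s) =
      s k ×ˢ Set.univ.pi (Function.update s k Set.univ) := by
    ext ⟨x, J⟩
    simp only [Set.mem_preimage, Set.mem_univ_pi, Set.mem_prod]
    constructor
    · intro H
      refine ⟨by simpa using H k, fun i => ?_⟩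
      by_cases hik : i = k
      · subst hik; simp
      · simpa [Function.update_of_ne hik] using H i
    · rintro ⟨H1, H2⟩ i
      by_cases hik : i = k
      · subst hik; simpa using H1
      · simpa [Function.update_of_ne hik] using H2 i
  rw [this, Measure.prod_prod, Measure.pi_pi,
    ← Finset.mul_prod_erase _ (fun i => μ i (s i)) (Finset.mem_univ k),
    ← Finset.mul_prod_erase _ (fun i => μ i (Function.update s k Set.univ i)) (Finset.mem_univ k)]
  simp only [Function.update_self, measure_univ, one_mul]
  congr 1
  refine Finset.prod_congr rfl fun i hi => ?_
  rw [Function.update_of_ne (Finset.ne_of_mem_erase hi)]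

/-- Gaussian integration by parts in one coordinate. -/
theorem integral_eval_mul_piGaussian {ι : Type*} [Fintype ι] [DecidableEq ι] (k : ι)
    {f f' : (ι → ℝ) → ℝ}
    (hf : ∀ J x, HasDerivAt (fun y => f (Function.update J k y)) (f' (Function.update J k x)) x)
    (hi : Integrable f (piGaussian ι)) (hi' : Integrable f' (piGaussian ι))
    (hxi : Integrable (fun J => J k * f J) (piGaussian ι)) :
    ∫ J, J k * f J ∂piGaussian ι = ∫ J, f' J ∂piGaussian ι := by
  have hmp := measurePreserving_update (fun _ : ι => gaussianReal 0 1) k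
  have key : ∀ g : (ι → ℝ) → ℝ, Integrable g (piGaussian ι) →
      Integrable (fun p : ℝ × (ι → ℝ) => g (Function.update p.2 k p.1))
        ((gaussianReal 0 1).prod (piGaussian ι)) ∧
      ∫ J, g J ∂piGaussian ι =
        ∫ J, ∫ x, g (Function.update J k x) ∂gaussianReal 0 1 ∂piGaussian ι := by
    intro g hg
    have h1 : Integrable (fun p : ℝ × (ι → ℝ) => g (Function.update p.2 k p.1))
        ((gaussianReal 0 1).prod (piGaussian ι)) := hmp.integrable_comp_of_integrable hg
    refine ⟨h1, ?_⟩
    rw [← integral_prod_symm (fun p : ℝ × (ι → ℝ) => g (Function.update p.2 k p.1)) h1]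
    conv_lhs => rw [piGaussian, ← hmp.map_eq]
    rw [integral_map hmp.aemeasurable]
    rw [hmp.map_eq]
    exact hg.aestronglyMeasurable
  obtain ⟨a1, -⟩ := key _ hi
  obtain ⟨a2, b2⟩ := key _ hi'
  obtain ⟨a3, b3⟩ := key _ hxi
  rw [b2, b3]
  refine integral_congr_ae ?_
  filter_upwards [a1.prod_left_ae, a2.prod_left_ae, a3.prod_left_ae] with J h1 h2 h3
  simp only [Function.update_self] at h3 ⊢
  exact integral_id_mul_gaussianReal (hf J) h1 h2 h3

theorem integrable_exp_sum_abs_piGaussian (ι : Type*) [Fintype ι] (K : ℝ) :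
    Integrable (fun J : ι → ℝ => rexp (K * ∑ k, |J k|)) (piGaussian ι) := by
  have : Integrable (fun J : ι → ℝ => ∏ k, rexp (K * |J k|)) (piGaussian ι) :=
    Integrable.fintype_prod fun _ => integrable_exp_mul_abs (X := fun x => x)
      (integrable_exp_mul_gaussianReal K) (integrable_exp_mul_gaussianReal (-K))
  refine this.congr (ae_of_all _ fun J => ?_)
  simp only [Finset.mul_sum, Real.exp_sum]

theorem integral_exp_sum_mul_piGaussian {ι : Type*} [Fintype ι] (v : ι → ℝ) :
    ∫ J : ι → ℝ, rexp (∑ k, v k * J k) ∂piGaussian ι = rexp ((∑ k, v k ^ 2) / 2) := by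
  have h1 : ∀ t : ℝ, ∫ x, rexp (t * x) ∂gaussianReal 0 1 = rexp (t ^ 2 / 2) := fun t => by
    simpa [mgf] using congrFun (mgf_id_gaussianReal (μ := 0) (v := 1)) t
  simp only [Real.exp_sum, Finset.sum_div]
  rw [integral_fintype_prod_eq_prod (fun k x => rexp (v k * x))]
  simp only [h1]

section Interpolation

variable {S ι κ : Type*} [Fintype ι] [Fintype κ]

/-- The Boltzmann weight of the configuration `σ` for the Gaussian energy `∑ k, v σ k * J k`
shifted by `c σ`. -/
def boltzmann (v : S → ι → ℝ) (c : S → ℝ) (J : ι → ℝ) (σ : S) : ℝ :=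
  rexp (∑ k, v σ k * J k + c σ)

theorem boltzmann_pos (v : S → ι → ℝ) (c : S → ℝ) (J : ι → ℝ) (σ : S) :
    0 < boltzmann v c J σ := Real.exp_pos _

theorem continuous_boltzmann (v : S → ι → ℝ) (c : S → ℝ) (σ : S) :
    Continuous fun J => boltzmann v c J σ := by
  unfold boltzmann; fun_prop

variable [Fintype S]

/-- The partition function of the Gaussian energies `∑ k, v σ k * J k` shifted by `c σ`. -/
def partitionFn (v : S → ι → ℝ) (c : S → ℝ) (J : ι → ℝ) : ℝ :=
  ∑ σ, boltzmann v c J σ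

theorem partitionFn_pos [Nonempty S] (v : S → ι → ℝ) (c : S → ℝ) (J : ι → ℝ) :
    0 < partitionFn v c J :=
  Finset.sum_pos (fun σ _ => boltzmann_pos v c J σ) Finset.univ_nonempty

theorem boltzmann_le_partitionFn (v : S → ι → ℝ) (c : S → ℝ) (J : ι → ℝ) (σ : S) :
    boltzmann v c J σ ≤ partitionFn v c J :=
  Finset.single_le_sum (fun τ _ => (boltzmann_pos v c J τ).le) (Finset.mem_univ σ)

theorem continuous_partitionFn (v : S → ι → ℝ) (c : S → ℝ) :
    Continuous fun J => partitionFn v c J :=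
  continuous_finsetSum _ fun σ _ => continuous_boltzmann v c σ

theorem continuous_partitionFn_rpow [Nonempty S] (v : S → ι → ℝ) (c : S → ℝ) (p : ℝ) :
    Continuous fun J => partitionFn v c J ^ p :=
  (continuous_partitionFn v c).rpow_const fun J => Or.inl (partitionFn_pos v c J).ne'

theorem Real.rpow_le_one_add {z n : ℝ} (hz : 0 < z) (hn : n ∈ Set.Ioc (0 : ℝ) 1) :
    z ^ n ≤ 1 + z := by
  rcases le_total z 1 with h | h
  · linarith [Real.rpow_le_one hz.le h hn.1.le]
  · refine (Real.rpow_le_rpow_of_exponent_le h hn.2).trans ?_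
    rw [Real.rpow_one]
    linarith

theorem abs_sum_mul_le {w J : ι → ℝ} {K : ℝ} (hw : ∀ k, |w k| ≤ K) :
    |∑ k, w k * J k| ≤ K * ∑ k, |J k| := by
  rw [Finset.mul_sum]
  refine (Finset.abs_sum_le_sum_abs _ _).trans (Finset.sum_le_sum fun k _ => ?_)
  rw [abs_mul]
  exact mul_le_mul_of_nonneg_right (hw k) (abs_nonneg _)

theorem partitionFn_rpow_le [Nonempty S] {v : S → ι → ℝ} {c : S → ℝ} {n K : ℝ}
    (hn : n ∈ Set.Ioc (0 : ℝ) 1) (hK : 0 ≤ K) (hv : ∀ σ k, |v σ k| ≤ K) (J : ι → ℝ) :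
    partitionFn v c J ^ n ≤ (1 + ∑ σ, rexp (c σ)) * rexp (K * ∑ k, |J k|) := by
  refine (Real.rpow_le_one_add (partitionFn_pos v c J) hn).trans ?_
  have h0 : 0 ≤ K * ∑ k, |J k| := by positivity
  rw [add_mul, one_mul, partitionFn, Finset.sum_mul]
  refine add_le_add (Real.one_le_exp h0) (Finset.sum_le_sum fun σ _ => ?_)
  rw [boltzmann, ← Real.exp_add, add_comm]
  gcongr
  exact (le_abs_self _).trans (abs_sum_mul_le (hv σ))

theorem exists_abs_le_of_finite (v : S → ι → ℝ) : ∃ K, 0 ≤ K ∧ ∀ σ k, |v σ k| ≤ K := by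
  refine ⟨∑ σ, ∑ k, |v σ k|, by positivity, fun σ k => ?_⟩
  exact (Finset.single_le_sum (f := fun k => |v σ k|) (fun _ _ => abs_nonneg _)
    (Finset.mem_univ k)).trans
    (Finset.single_le_sum (f := fun σ => ∑ k, |v σ k|) (fun _ _ => by positivity)
      (Finset.mem_univ σ))

theorem sum_abs_le_exp (J : ι → ℝ) : ∑ k, |J k| ≤ rexp (1 * ∑ k, |J k|) := by
  rw [one_mul]
  linarith [Real.add_one_le_exp (∑ k, |J k|)]

theorem integrable_of_abs_le_partitionFn_rpow [Nonempty S] (v : S → ι → ℝ) (c : S → ℝ) {n : ℝ}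
    (hn : n ∈ Set.Ioc (0 : ℝ) 1) {f : (ι → ℝ) → ℝ} (hf : Continuous f)
    (hb : ∀ J, |f J| ≤ (1 + ∑ k, |J k|) * partitionFn v c J ^ n) :
    Integrable f (piGaussian ι) := by
  obtain ⟨K, hK, hv⟩ := exists_abs_le_of_finite v
  refine Integrable.mono' ((integrable_exp_sum_abs_piGaussian ι (1 + K)).const_mul
    (1 + ∑ σ, rexp (c σ))) hf.aestronglyMeasurable (ae_of_all _ fun J => ?_)
  rw [Real.norm_eq_abs]
  refine (hb J).trans ?_
  have h1 : 1 + ∑ k, |J k| ≤ rexp (1 * ∑ k, |J k|) := by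
    rw [one_mul]
    linarith [Real.add_one_le_exp (∑ k, |J k|)]
  calc _ ≤ rexp (1 * ∑ k, |J k|) * ((1 + ∑ σ, rexp (c σ)) * rexp (K * ∑ k, |J k|)) :=
        mul_le_mul h1 (partitionFn_rpow_le hn hK hv J)
          (Real.rpow_nonneg (partitionFn_pos v c J).le _) (Real.exp_nonneg _)
    _ = _ := by rw [add_mul 1 K, Real.exp_add]; ring

theorem boltzmann_mul_rpow_le [Nonempty S] (v : S → ι → ℝ) (c : S → ℝ) (J : ι → ℝ) (σ : S)
    (n : ℝ) : boltzmann v c J σ * partitionFn v c J ^ (n - 1) ≤ partitionFn v c J ^ n := by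
  have hZ := partitionFn_pos v c J
  calc _ ≤ partitionFn v c J * partitionFn v c J ^ (n - 1) := by
        gcongr; exact boltzmann_le_partitionFn v c J σ
    _ = _ := by rw [Real.rpow_sub_one hZ.ne']; field_simp

theorem boltzmann_mul_boltzmann_mul_rpow_le [Nonempty S] (v : S → ι → ℝ) (c : S → ℝ) (J : ι → ℝ)
    (σ τ : S) (n : ℝ) :
    boltzmann v c J σ * boltzmann v c J τ * partitionFn v c J ^ (n - 2) ≤
      partitionFn v c J ^ n := by
  have hZ := partitionFn_pos v c J
  have hσ := boltzmann_pos v c J σ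
  calc _ = boltzmann v c J σ * (boltzmann v c J τ * partitionFn v c J ^ (n - 1 - 1)) := by
        rw [show n - 1 - 1 = n - 2 by ring]; ring
    _ ≤ boltzmann v c J σ * partitionFn v c J ^ (n - 1) := by
        gcongr; exact boltzmann_mul_rpow_le v c J τ (n - 1)
    _ ≤ _ := boltzmann_mul_rpow_le v c J σ n

theorem integrable_partitionFn_rpow [Nonempty S] (v : S → ι → ℝ) (c : S → ℝ) {n : ℝ}
    (hn : n ∈ Set.Ioc (0 : ℝ) 1) :
    Integrable (fun J => partitionFn v c J ^ n) (piGaussian ι) := by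
  refine integrable_of_abs_le_partitionFn_rpow v c hn (continuous_partitionFn_rpow v c n)
    fun J => ?_
  have := Real.rpow_nonneg (partitionFn_pos v c J).le n
  rw [abs_of_nonneg this]
  exact le_mul_of_one_le_left this (le_add_of_nonneg_right (by positivity))

theorem integrable_boltzmann_mul [Nonempty S] (v : S → ι → ℝ) (c : S → ℝ) {n : ℝ}
    (hn : n ∈ Set.Ioc (0 : ℝ) 1) (σ : S) :
    Integrable (fun J => boltzmann v c J σ * partitionFn v c J ^ (n - 1)) (piGaussian ι) := by
  refine (integrable_partitionFn_rpow v c hn).mono'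
    ((continuous_boltzmann v c σ).mul
      (continuous_partitionFn_rpow v c _)).aestronglyMeasurable (ae_of_all _ fun J => ?_)
  rw [Real.norm_of_nonneg (mul_nonneg (boltzmann_pos v c J σ).le
    (Real.rpow_nonneg (partitionFn_pos v c J).le _))]
  exact boltzmann_mul_rpow_le v c J σ n

theorem integrable_boltzmann_mul_boltzmann_mul [Nonempty S] (v : S → ι → ℝ) (c : S → ℝ) {n : ℝ}
    (hn : n ∈ Set.Ioc (0 : ℝ) 1) (σ τ : S) :
    Integrable (fun J => boltzmann v c J σ * boltzmann v c J τ * partitionFn v c J ^ (n - 2))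
      (piGaussian ι) := by
  refine (integrable_partitionFn_rpow v c hn).mono'
    (((continuous_boltzmann v c σ).mul (continuous_boltzmann v c τ)).mul
      (continuous_partitionFn_rpow v c _)).aestronglyMeasurable (ae_of_all _ fun J => ?_)
  rw [Real.norm_of_nonneg (mul_nonneg (mul_pos (boltzmann_pos v c J σ) (boltzmann_pos v c J τ)).le
    (Real.rpow_nonneg (partitionFn_pos v c J).le _))]
  exact boltzmann_mul_boltzmann_mul_rpow_le v c J σ τ n

theorem integrable_eval_mul_boltzmann_mul [Nonempty S] (v : S → ι → ℝ) (c : S → ℝ) {n : ℝ}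
    (hn : n ∈ Set.Ioc (0 : ℝ) 1) (σ : S) (k : ι) :
    Integrable (fun J => J k * (boltzmann v c J σ * partitionFn v c J ^ (n - 1)))
      (piGaussian ι) := by
  refine integrable_of_abs_le_partitionFn_rpow v c hn
    ((continuous_apply k).mul ((continuous_boltzmann v c σ).mul
      (continuous_partitionFn_rpow v c _))) fun J => ?_
  have h0 : 0 ≤ boltzmann v c J σ * partitionFn v c J ^ (n - 1) :=
    mul_nonneg (boltzmann_pos v c J σ).le (Real.rpow_nonneg (partitionFn_pos v c J).le _)
  rw [abs_mul, abs_of_nonneg h0]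
  refine mul_le_mul ?_ (boltzmann_mul_rpow_le v c J σ n) h0 (by positivity)
  have := Finset.single_le_sum (f := fun k => |J k|) (fun _ _ => abs_nonneg _) (Finset.mem_univ k)
  linarith

theorem integral_eval_mul_boltzmann_mul [Nonempty S] (v : S → ι → ℝ) (c : S → ℝ)
    {n : ℝ} (hn : n ∈ Set.Ioc (0 : ℝ) 1) (σ : S) (k : ι) :
    ∫ J, J k * (boltzmann v c J σ * partitionFn v c J ^ (n - 1)) ∂piGaussian ι =
      v σ k * ∫ J, boltzmann v c J σ * partitionFn v c J ^ (n - 1) ∂piGaussian ι -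
      (1 - n) * ∑ τ, v τ k *
        ∫ J, boltzmann v c J σ * boltzmann v c J τ * partitionFn v c J ^ (n - 2)
          ∂piGaussian ι := by
  classical
  have hB := fun τ => (integrable_boltzmann_mul_boltzmann_mul v c hn σ τ).const_mul (v τ k)
  have hA := (integrable_boltzmann_mul v c hn σ).const_mul (v σ k)
  have hS := (integrable_finsetSum Finset.univ fun τ _ => hB τ).const_mul (1 - n)
  have hd : ∀ (τ : S) (J : ι → ℝ) (x : ℝ),
      HasDerivAt (fun y => boltzmann v c (Function.update J k y) τ)
        (v τ k * boltzmann v c (Function.update J k x) τ) x := by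
    intro τ J x
    have h1 : HasDerivAt (fun y => ∑ i, v τ i * Function.update J k y i + c τ) (v τ k) x := by
      have := (HasDerivAt.fun_sum (u := Finset.univ) fun i _ =>
        ((hasDerivAt_pi.1 (hasDerivAt_update J k x) i).const_mul (v τ i))).add_const (c τ)
      refine this.congr_deriv ?_
      simp [Pi.single_apply]
    exact h1.exp.congr_deriv (mul_comm _ _)
  rw [integral_eval_mul_piGaussian k (f' := fun J =>
    v σ k * (boltzmann v c J σ * partitionFn v c J ^ (n - 1)) -
      (1 - n) * ∑ τ, v τ k *
        (boltzmann v c J σ * boltzmann v c J τ * partitionFn v c J ^ (n - 2))) ?_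
    (integrable_boltzmann_mul v c hn σ) (hA.sub hS)
    (integrable_eval_mul_boltzmann_mul v c hn σ k)]
  · rw [integral_sub hA hS, integral_const_mul, integral_const_mul,
      integral_finsetSum _ fun τ _ => hB τ]
    simp only [integral_const_mul]
  · intro J x
    have hZ : HasDerivAt (fun y => partitionFn v c (Function.update J k y))
        (∑ τ, v τ k * boltzmann v c (Function.update J k x) τ) x :=
      HasDerivAt.fun_sum fun τ _ => hd τ J x
    refine ((hd σ J x).mul (hZ.rpow_const (p := n - 1)
      (Or.inl (partitionFn_pos _ _ _).ne'))).congr_deriv ?_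
    rw [show n - 1 - 1 = n - 2 by ring]
    simp only [Finset.sum_mul, Finset.mul_sum]
    rw [sub_eq_add_neg _ (∑ τ, _), ← Finset.sum_neg_distrib]
    congr 1
    · ring
    · exact Finset.sum_congr rfl fun τ _ => by ring

/-- The derivative of `E[Z_t ^ n]` along a differentiable family of Gaussian energies, after
Gaussian integration by parts. -/
theorem hasDerivAt_integral_partitionFn_rpow [Nonempty S] {v v' : ℝ → S → ι → ℝ} {K : ℝ}
    (c : S → ℝ) {n : ℝ} (hn : n ∈ Set.Ioc (0 : ℝ) 1) (hK : 0 ≤ K)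
    (hv : ∀ t σ k, HasDerivAt (fun s => v s σ k) (v' t σ k) t)
    (hvK : ∀ t σ k, |v t σ k| ≤ K) (hvK' : ∀ t σ k, |v' t σ k| ≤ K) (t : ℝ) :
    HasDerivAt (fun s => ∫ J, partitionFn (v s) c J ^ n ∂piGaussian ι)
      (n * ∑ σ, ((∑ k, v' t σ k * v t σ k) *
          ∫ J, boltzmann (v t) c J σ * partitionFn (v t) c J ^ (n - 1) ∂piGaussian ι -
        (1 - n) * ∑ τ, (∑ k, v' t σ k * v t τ k) *
          ∫ J, boltzmann (v t) c J σ * boltzmann (v t) c J τ * partitionFn (v t) c J ^ (n - 2)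
            ∂piGaussian ι)) t := by
  set F' : ℝ → (ι → ℝ) → ℝ := fun s J =>
    n * ∑ σ, ∑ k, v' s σ k * (J k * (boltzmann (v s) c J σ * partitionFn (v s) c J ^ (n - 1)))
    with hF'
  have hbd : ∀ (J : ι → ℝ) (s : ℝ), ‖F' s J‖ ≤
      (Fintype.card S * K * (1 + ∑ σ, rexp (c σ))) * rexp ((1 + K) * ∑ k, |J k|) := by
    intro J s
    have hZ := partitionFn_pos (v s) c J
    have hterm : ∀ σ, |∑ k, v' s σ k *
        (J k * (boltzmann (v s) c J σ * partitionFn (v s) c J ^ (n - 1)))| ≤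
        K * rexp (1 * ∑ k, |J k|) * ((1 + ∑ σ, rexp (c σ)) * rexp (K * ∑ k, |J k|)) := by
      intro σ
      simp only [← mul_assoc (_ : ℝ) (J _)]
      have hE := boltzmann_pos (v s) c J σ
      rw [← Finset.sum_mul, abs_mul, abs_of_nonneg (a := boltzmann _ _ _ _ * _) (by positivity)]
      refine mul_le_mul ((abs_sum_mul_le (hvK' s σ)).trans
        (mul_le_mul_of_nonneg_left (sum_abs_le_exp J) hK))
        ((boltzmann_mul_rpow_le _ c J σ n).trans (partitionFn_rpow_le hn hK (hvK s) J))
        (by positivity) (by positivity)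
    rw [Real.norm_eq_abs, hF', abs_mul, abs_of_pos hn.1]
    calc _ ≤ 1 * ∑ σ : S,
          K * rexp (1 * ∑ k, |J k|) * ((1 + ∑ σ, rexp (c σ)) * rexp (K * ∑ k, |J k|)) := by
          refine mul_le_mul hn.2 ((Finset.abs_sum_le_sum_abs _ _).trans
            (Finset.sum_le_sum fun σ _ => hterm σ)) (abs_nonneg _) zero_le_one
      _ = _ := by
          rw [Finset.sum_const, Finset.card_univ, nsmul_eq_mul, add_mul 1 K, Real.exp_add]
          ring
  have hI := fun σ k => (integrable_eval_mul_boltzmann_mul (v t) c hn σ k).const_mul (v' t σ k)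
  have hIs := fun σ => integrable_finsetSum Finset.univ fun k _ => hI σ k
  have hIF' : Integrable (F' t) (piGaussian ι) :=
    (integrable_finsetSum Finset.univ fun σ _ => hIs σ).const_mul n
  have hmain := (hasDerivAt_integral_of_dominated_loc_of_deriv_le
    (F := fun s J => partitionFn (v s) c J ^ n) (F' := F') (x₀ := t) (s := Set.univ)
    (μ := piGaussian ι) Filter.univ_mem
    (Eventually.of_forall fun s => (integrable_partitionFn_rpow (v s) c hn).aestronglyMeasurable)
    (integrable_partitionFn_rpow (v t) c hn) hIF'.aestronglyMeasurable
    (ae_of_all _ fun J s _ => hbd J s)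
    ((integrable_exp_sum_abs_piGaussian ι (1 + K)).const_mul _)
    (ae_of_all _ fun J s _ => ?_)).2
  · refine hmain.congr_deriv ?_
    rw [hF', integral_const_mul, integral_finsetSum _ fun σ _ => hIs σ]
    congr 1
    refine Finset.sum_congr rfl fun σ _ => ?_
    rw [integral_finsetSum _ fun k _ => hI σ k]
    simp only [integral_const_mul, integral_eval_mul_boltzmann_mul (v t) c hn σ, mul_sub,
      Finset.sum_sub_distrib]
    congr 1
    · rw [Finset.sum_mul]
      exact Finset.sum_congr rfl fun k _ => by ring
    · simp only [Finset.mul_sum, Finset.sum_mul]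
      rw [Finset.sum_comm]
      exact Finset.sum_congr rfl fun τ _ => Finset.sum_congr rfl fun k _ => by ring
  · have hE : ∀ σ, HasDerivAt (fun s => boltzmann (v s) c J σ)
        ((∑ k, v' s σ k * J k) * boltzmann (v s) c J σ) s := fun σ => by
      have h1 : HasDerivAt (fun s => ∑ k, v s σ k * J k + c σ) (∑ k, v' s σ k * J k) s :=
        (HasDerivAt.fun_sum fun k _ => (hv s σ k).mul_const (J k)).add_const _
      exact h1.exp.congr_deriv (mul_comm _ _)
    have hZ : HasDerivAt (fun s => partitionFn (v s) c J)
        (∑ σ, (∑ k, v' s σ k * J k) * boltzmann (v s) c J σ) s :=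
      HasDerivAt.fun_sum fun σ _ => hE σ
    refine (hZ.rpow_const (p := n) (Or.inl (partitionFn_pos _ _ _).ne')).congr_deriv ?_
    simp only [hF', Finset.sum_mul, Finset.mul_sum]
    exact Finset.sum_congr rfl fun σ _ => Finset.sum_congr rfl fun k _ => by ring

theorem measurePreserving_comp_inl :
    MeasurePreserving (fun J : ι ⊕ κ → ℝ => fun k => J (Sum.inl k))
      (piGaussian (ι ⊕ κ)) (piGaussian ι) :=
  measurePreserving_fst.comp
    (measurePreserving_sumPiEquivProdPi (X := fun _ : ι ⊕ κ => ℝ) fun _ => gaussianReal 0 1)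

theorem measurePreserving_comp_inr :
    MeasurePreserving (fun J : ι ⊕ κ → ℝ => fun k => J (Sum.inr k))
      (piGaussian (ι ⊕ κ)) (piGaussian κ) :=
  measurePreserving_snd.comp
    (measurePreserving_sumPiEquivProdPi (X := fun _ : ι ⊕ κ => ℝ) fun _ => gaussianReal 0 1)

/-- A Gaussian comparison inequality: raising the variances of the energies by `d` while raising
no covariance by more than `d` raises the fractional moment `E[Z ^ n]`. -/
theorem integral_partitionFn_rpow_le [Nonempty S] {a : S → ι → ℝ} {b : S → κ → ℝ} {c : S → ℝ}
    {n d : ℝ} (hn : n ∈ Set.Ioc (0 : ℝ) 1) (hd : 0 ≤ d)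
    (hdiag : ∀ σ, ∑ k, a σ k * a σ k - ∑ k, b σ k * b σ k = d)
    (hoff : ∀ σ τ, ∑ k, a σ k * a τ k - ∑ k, b σ k * b τ k ≤ d) :
    ∫ J, partitionFn b c J ^ n ∂piGaussian κ ≤ ∫ J, partitionFn a c J ^ n ∂piGaussian ι := by
  set v : ℝ → S → ι ⊕ κ → ℝ := fun t σ =>
    Sum.elim (fun k => Real.sin t * a σ k) (fun k => Real.cos t * b σ k) with hv
  set v' : ℝ → S → ι ⊕ κ → ℝ := fun t σ =>
    Sum.elim (fun k => Real.cos t * a σ k) (fun k => -Real.sin t * b σ k) with hv'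
  obtain ⟨A, hA, ha⟩ := exists_abs_le_of_finite a
  obtain ⟨B, hB, hb⟩ := exists_abs_le_of_finite b
  have hle : ∀ {x y M : ℝ}, |x| ≤ 1 → |y| ≤ M → |x * y| ≤ M := fun {x y M} hx hy => by
    rw [abs_mul]; nlinarith [abs_nonneg x, abs_nonneg y]
  have hderiv := hasDerivAt_integral_partitionFn_rpow (v := v) (v' := v') (K := A + B) c hn
    (by positivity)
    (by
      rintro t σ (k | k)
      · exact (Real.hasDerivAt_sin t).mul_const _
      · exact (Real.hasDerivAt_cos t).mul_const _)
    (by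
      rintro t σ (k | k)
      · exact (hle (Real.abs_sin_le_one t) (ha σ k)).trans (by linarith)
      · exact (hle (Real.abs_cos_le_one t) (hb σ k)).trans (by linarith))
    (by
      rintro t σ (k | k)
      · exact (hle (Real.abs_cos_le_one t) (ha σ k)).trans (by linarith)
      · exact (hle (by simpa using Real.abs_sin_le_one t) (hb σ k)).trans (by linarith))
  have hmono : MonotoneOn (fun t => ∫ J, partitionFn (v t) c J ^ n ∂piGaussian (ι ⊕ κ))
      (Set.Icc 0 (π / 2)) := by
    refine monotoneOn_of_deriv_nonneg (convex_Icc _ _)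
      (fun t _ => (hderiv t).continuousAt.continuousWithinAt)
      (fun t _ => (hderiv t).differentiableAt.differentiableWithinAt) fun t ht => ?_
    rw [interior_Icc] at ht
    rw [(hderiv t).deriv]
    have hsc : 0 ≤ Real.sin t * Real.cos t :=
      mul_nonneg (Real.sin_nonneg_of_nonneg_of_le_pi ht.1.le (by linarith [ht.2, Real.pi_pos]))
        (Real.cos_nonneg_of_neg_pi_div_two_le_of_le (by linarith [ht.1, Real.pi_pos]) ht.2.le)
    have hcov : ∀ σ τ, ∑ k, v' t σ k * v t τ k =
        Real.sin t * Real.cos t * (∑ k, a σ k * a τ k - ∑ k, b σ k * b τ k) := by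
      intro σ τ
      rw [Fintype.sum_sum_type, mul_sub, sub_eq_add_neg, Finset.mul_sum, Finset.mul_sum,
        ← Finset.sum_neg_distrib]
      congr 1
      · exact Finset.sum_congr rfl fun k _ => by simp only [hv, hv', Sum.elim_inl]; ring
      · exact Finset.sum_congr rfl fun k _ => by simp only [hv, hv', Sum.elim_inr]; ring
    refine mul_nonneg hn.1.le (Finset.sum_nonneg fun σ _ => sub_nonneg.2 ?_)
    have hZ := partitionFn_pos (v t) c
    have hE := boltzmann_pos (v t) c
    have hsum : ∑ τ, ∫ J, boltzmann (v t) c J σ * boltzmann (v t) c J τ *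
          partitionFn (v t) c J ^ (n - 2) ∂piGaussian (ι ⊕ κ) =
        ∫ J, boltzmann (v t) c J σ * partitionFn (v t) c J ^ (n - 1) ∂piGaussian (ι ⊕ κ) := by
      rw [← integral_finsetSum _ fun τ _ =>
        integrable_boltzmann_mul_boltzmann_mul (v t) c hn σ τ]
      refine integral_congr_ae (ae_of_all _ fun J => ?_)
      dsimp only
      rw [← Finset.sum_mul, ← Finset.mul_sum, ← partitionFn, show n - 2 = n - 1 - 1 by ring,
        Real.rpow_sub_one (hZ J).ne' (n - 1)]
      have := (hZ J).ne'
      field_simp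
    have hI : 0 ≤ ∫ J, boltzmann (v t) c J σ * partitionFn (v t) c J ^ (n - 1)
        ∂piGaussian (ι ⊕ κ) :=
      integral_nonneg fun J => mul_nonneg (hE J σ).le (Real.rpow_nonneg (hZ J).le _)
    calc _ ≤ (1 - n) * ∑ τ, (Real.sin t * Real.cos t * d) *
          ∫ J, boltzmann (v t) c J σ * boltzmann (v t) c J τ *
            partitionFn (v t) c J ^ (n - 2) ∂piGaussian (ι ⊕ κ) := by
          refine mul_le_mul_of_nonneg_left (Finset.sum_le_sum fun τ _ => ?_)
            (sub_nonneg.2 hn.2)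
          rw [hcov]
          refine mul_le_mul_of_nonneg_right (mul_le_mul_of_nonneg_left (hoff σ τ) hsc)
            (integral_nonneg fun J => mul_nonneg (mul_pos (hE J σ) (hE J τ)).le
              (Real.rpow_nonneg (hZ J).le _))
      _ ≤ _ := by
          rw [← Finset.mul_sum, hsum, hcov, hdiag]
          have : 0 ≤ Real.sin t * Real.cos t * d := mul_nonneg hsc hd
          have := mul_nonneg this hI
          nlinarith [hn.1]
  have h0 := hmono (Set.left_mem_Icc.2 (by positivity)) (Set.right_mem_Icc.2 (by positivity))
    (by positivity : (0 : ℝ) ≤ π / 2)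
  have hb0 : ∫ J, partitionFn b c J ^ n ∂piGaussian κ =
      ∫ J, partitionFn (v 0) c J ^ n ∂piGaussian (ι ⊕ κ) := by
    rw [← (measurePreserving_comp_inr (ι := ι) (κ := κ)).map_eq, integral_map
      measurePreserving_comp_inr.aemeasurable
      (continuous_partitionFn_rpow b c n).aestronglyMeasurable]
    simp [partitionFn, boltzmann, hv]
  have ha0 : ∫ J, partitionFn a c J ^ n ∂piGaussian ι =
      ∫ J, partitionFn (v (π / 2)) c J ^ n ∂piGaussian (ι ⊕ κ) := by
    rw [← (measurePreserving_comp_inl (ι := ι) (κ := κ)).map_eq, integral_map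
      measurePreserving_comp_inl.aemeasurable
      (continuous_partitionFn_rpow a c n).aestronglyMeasurable]
    simp [partitionFn, boltzmann, hv]
  rw [hb0, ha0]
  exact h0

end Interpolation

theorem integral_partitionFn_rpow_pos {S ι : Type*} [Fintype S] [Fintype ι] [Nonempty S]
    (v : S → ι → ℝ) (c : S → ℝ) {n : ℝ} (hn : n ∈ Set.Ioc (0 : ℝ) 1) :
    0 < ∫ J, partitionFn v c J ^ n ∂piGaussian ι := by
  have h := integrable_partitionFn_rpow v c hn
  simp only [fun J => Real.rpow_def_of_pos (partitionFn_pos v c J)] at h ⊢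
  exact integral_exp_pos h

/-- An upper bound for a fractional moment by the first moment. -/
theorem integral_partitionFn_rpow_le_one_add {S ι : Type*} [Fintype S] [Fintype ι] [Nonempty S]
    (v : S → ι → ℝ) (c : S → ℝ) {n : ℝ} (hn : n ∈ Set.Ioc (0 : ℝ) 1) :
    ∫ J, partitionFn v c J ^ n ∂piGaussian ι ≤
      1 + ∑ σ, rexp ((∑ k, v σ k ^ 2) / 2 + c σ) := by
  have h1 : Integrable (fun J => partitionFn v c J) (piGaussian ι) := by
    simpa using integrable_partitionFn_rpow v c (n := 1) ⟨one_pos, le_rfl⟩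
  have hb : ∀ σ, Integrable (fun J => boltzmann v c J σ) (piGaussian ι) := fun σ => by
    simpa using integrable_boltzmann_mul v c (n := 1) ⟨one_pos, le_rfl⟩ σ
  calc ∫ J, partitionFn v c J ^ n ∂piGaussian ι
      ≤ ∫ J, (1 + partitionFn v c J) ∂piGaussian ι :=
        integral_mono (integrable_partitionFn_rpow v c hn) ((integrable_const 1).add h1)
          fun J => Real.rpow_le_one_add (partitionFn_pos v c J) hn
    _ = _ := by
        rw [integral_add (integrable_const 1) h1]
        simp only [partitionFn]
        rw [integral_finsetSum _ fun σ _ => hb σ]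
        simp [boltzmann, Real.exp_add, integral_mul_const, integral_exp_sum_mul_piGaussian]

/-- The coefficients of the couplings in `-β * skH N h J σ`. -/
def skCoeff (N : ℕ) (β : ℝ) (σ : Fin N → Bool) (p : Fin N × Fin N) : ℝ :=
  if p.1 < p.2 then β / √N * (spinVal (σ p.1) * spinVal (σ p.2)) else 0

/-- The field contribution to `-β * skH N h J σ`. -/
def skField (N : ℕ) (β h : ℝ) (σ : Fin N → Bool) : ℝ := β * h * ∑ i, spinVal (σ i)

theorem spinVal_mul_self (b : Bool) : spinVal b * spinVal b = 1 := by
  cases b <;> simp [spinVal]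

theorem abs_spinVal (b : Bool) : |spinVal b| = 1 := by
  cases b <;> simp [spinVal]

theorem skZ_eq_partitionFn (N : ℕ) (β h : ℝ) (J : Fin N × Fin N → ℝ) :
    skZ N β h J = partitionFn (skCoeff N β) (skField N β h) J := by
  refine Finset.sum_congr rfl fun σ _ => ?_
  rw [boltzmann, skH, skField, Finset.sum_filter, mul_sub, ← mul_assoc (-β), Finset.mul_sum,
    sub_eq_add_neg]
  congr 2
  · refine Finset.sum_congr rfl fun p _ => ?_
    unfold skCoeff
    split_ifs <;> ring
  · ring

theorem sum_filter_lt_mul {N : ℕ} (y : Fin N → ℝ) :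
    2 * ∑ p : Fin N × Fin N, (if p.1 < p.2 then y p.1 * y p.2 else 0) =
      (∑ i, y i) ^ 2 - ∑ i, y i ^ 2 := by
  have hsplit : ∀ i j, y i * y j = (if i < j then y i * y j else 0) +
      (if j < i then y j * y i else 0) + (if i = j then y i ^ 2 else 0) := by
    intro i j
    rcases lt_trichotomy i j with h | h | h
    · simp [h, h.not_gt, h.ne]
    · subst h; simp [sq]
    · simp [h, h.not_gt, h.ne', mul_comm]
  rw [sq (∑ i, y i), Finset.sum_mul_sum]
  rw [Finset.sum_congr rfl fun i _ => Finset.sum_congr rfl fun j _ => hsplit i j]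
  simp only [Finset.sum_add_distrib]
  rw [Finset.sum_comm (f := fun i j => if j < i then y j * y i else 0), Fintype.sum_prod_type]
  simp
  ring

/-- The overlap sum `∑ i, σ i * τ i`. -/
def spinOverlap {N : ℕ} (σ τ : Fin N → Bool) : ℝ := ∑ i, spinVal (σ i) * spinVal (τ i)

theorem spinOverlap_self {N : ℕ} (σ : Fin N → Bool) : spinOverlap σ σ = N := by
  simp [spinOverlap, spinVal_mul_self]

theorem sum_skCoeff_mul {N : ℕ} (hN : 1 ≤ N) (β : ℝ) (σ τ : Fin N → Bool) :
    ∑ p, skCoeff N β σ p * skCoeff N β τ p = β ^ 2 / 2 * (spinOverlap σ τ ^ 2 / N - 1) := by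
  have hN' : (0 : ℝ) < N := by exact_mod_cast hN
  have h1 : ∀ p, skCoeff N β σ p * skCoeff N β τ p = β ^ 2 / N * (if p.1 < p.2 then
      (spinVal (σ p.1) * spinVal (τ p.1)) * (spinVal (σ p.2) * spinVal (τ p.2)) else 0) := by
    intro p
    unfold skCoeff
    split_ifs
    · rw [← Real.sq_sqrt hN'.le]
      simp only [Real.sqrt_sq (Real.sqrt_nonneg _)]
      ring
    · simp
  have h2 : ∑ i, (spinVal (σ i) * spinVal (τ i)) ^ 2 = (N : ℝ) := by
    have : ∀ i, (spinVal (σ i) * spinVal (τ i)) ^ 2 = 1 := fun i => by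
      rw [mul_pow, sq, sq, spinVal_mul_self, spinVal_mul_self, one_mul]
    simp [this]
  have h3 := sum_filter_lt_mul fun i => spinVal (σ i) * spinVal (τ i)
  rw [h2] at h3
  simp only [h1, ← Finset.mul_sum]
  rw [eq_div_of_mul_eq two_ne_zero ((mul_comm _ _).trans h3), spinOverlap]
  field_simp

/-- The coupling coefficients of two non-interacting SK systems. -/
def skBlockCoeff (N₁ N₂ : ℕ) (β : ℝ) (σ : Fin (N₁ + N₂) → Bool) :
    (Fin N₁ × Fin N₁) ⊕ (Fin N₂ × Fin N₂) → ℝ :=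
  Sum.elim (skCoeff N₁ β fun i => σ (Fin.castAdd N₂ i)) (skCoeff N₂ β fun i => σ (Fin.natAdd N₁ i))

theorem partitionFn_skBlockCoeff (N₁ N₂ : ℕ) (β h : ℝ)
    (J : (Fin N₁ × Fin N₁) ⊕ (Fin N₂ × Fin N₂) → ℝ) :
    partitionFn (skBlockCoeff N₁ N₂ β) (skField (N₁ + N₂) β h) J =
      partitionFn (skCoeff N₁ β) (skField N₁ β h) (fun k => J (Sum.inl k)) *
        partitionFn (skCoeff N₂ β) (skField N₂ β h) (fun k => J (Sum.inr k)) := by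
  simp only [partitionFn]
  rw [Finset.sum_mul_sum, ← Fintype.sum_prod_type', ← (Fin.appendEquiv N₁ N₂).sum_comp]
  refine Finset.sum_congr rfl fun σ _ => ?_
  simp only [boltzmann, ← Real.exp_add, skBlockCoeff, skField, Fintype.sum_sum_type,
    Fin.sum_univ_add, Sum.elim_inl, Sum.elim_inr, Fin.appendEquiv, Equiv.coe_fn_mk,
    Fin.append_left, Fin.append_right]
  congr 1
  ring

theorem integral_partitionFn_skBlockCoeff (N₁ N₂ : ℕ) (n β h : ℝ) :
    ∫ J, partitionFn (skBlockCoeff N₁ N₂ β) (skField (N₁ + N₂) β h) J ^ n ∂piGaussian _ =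
      (∫ J, partitionFn (skCoeff N₁ β) (skField N₁ β h) J ^ n ∂piGaussian _) *
        ∫ J, partitionFn (skCoeff N₂ β) (skField N₂ β h) J ^ n ∂piGaussian _ := by
  rw [← integral_prod_mul, ← (measurePreserving_sumPiEquivProdPi
    (X := fun _ : (Fin N₁ × Fin N₁) ⊕ (Fin N₂ × Fin N₂) => ℝ)
    fun _ => gaussianReal 0 1).integral_comp']
  refine integral_congr_ae (ae_of_all _ fun J => ?_)
  dsimp only
  rw [partitionFn_skBlockCoeff, Real.mul_rpow (partitionFn_pos _ _ _).le (partitionFn_pos _ _ _).le]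
  rfl

theorem skPsi_eq (N : ℕ) (n β h : ℝ) : skPsi N n β h =
    n⁻¹ * Real.log (∫ J, partitionFn (skCoeff N β) (skField N β h) J ^ n ∂piGaussian _) := by
  simp only [skPsi, skMuJ, skZ_eq_partitionFn]

theorem skPhi_eq (N : ℕ) (n β h : ℝ) : skPhi N n β h = skPsi N n β h / N := by
  rw [skPhi, skPsi, one_div, mul_inv]
  ring

theorem skPsi_zero (n β h : ℝ) : skPsi 0 n β h = 0 := by
  simp [skPsi, skZ, skH, skMuJ]

theorem add_sq_div_add_le_add_sq_div (x y : ℝ) {p q : ℝ} (hp : 0 < p) (hq : 0 < q) :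
    (x + y) ^ 2 / (p + q) ≤ x ^ 2 / p + y ^ 2 / q := by
  have h : x ^ 2 / p + y ^ 2 / q - (x + y) ^ 2 / (p + q) =
      (q * x - p * y) ^ 2 / (p * q * (p + q)) := by
    field_simp
    ring
  have : 0 ≤ (q * x - p * y) ^ 2 / (p * q * (p + q)) := by positivity
  linarith

theorem skPsi_add_le {n : ℝ} (β h : ℝ) (hn : n ∈ Set.Ioc (0 : ℝ) 1) {N₁ N₂ : ℕ}
    (h₁ : 1 ≤ N₁) (h₂ : 1 ≤ N₂) :
    skPsi N₁ n β h + skPsi N₂ n β h ≤ skPsi (N₁ + N₂) n β h := by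
  have hN₁ : (0 : ℝ) < N₁ := by exact_mod_cast h₁
  have hN₂ : (0 : ℝ) < N₂ := by exact_mod_cast h₂
  have hcov : ∀ σ τ : Fin (N₁ + N₂) → Bool,
      ∑ k, skCoeff (N₁ + N₂) β σ k * skCoeff (N₁ + N₂) β τ k -
        ∑ k, skBlockCoeff N₁ N₂ β σ k * skBlockCoeff N₁ N₂ β τ k =
      β ^ 2 / 2 * (1 + (spinOverlap σ τ ^ 2 / (N₁ + N₂) -
        spinOverlap (fun i => σ (Fin.castAdd N₂ i)) (fun i => τ (Fin.castAdd N₂ i)) ^ 2 / N₁ -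
        spinOverlap (fun i => σ (Fin.natAdd N₁ i)) (fun i => τ (Fin.natAdd N₁ i)) ^ 2 / N₂)) := by
    intro σ τ
    rw [Fintype.sum_sum_type]
    simp only [skBlockCoeff, Sum.elim_inl, Sum.elim_inr]
    rw [sum_skCoeff_mul (by lia), sum_skCoeff_mul h₁, sum_skCoeff_mul h₂]
    push_cast
    ring
  have hcmp := integral_partitionFn_rpow_le (a := skCoeff (N₁ + N₂) β)
    (b := skBlockCoeff N₁ N₂ β) (c := skField (N₁ + N₂) β h) (d := β ^ 2 / 2) hn (by positivity)
    (fun σ => by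
      rw [hcov, spinOverlap_self, spinOverlap_self, spinOverlap_self]
      push_cast
      field_simp
      ring)
    (fun σ τ => by
      rw [hcov]
      refine mul_le_of_le_one_right (by positivity) ?_
      have hadd : spinOverlap σ τ =
          spinOverlap (fun i => σ (Fin.castAdd N₂ i)) (fun i => τ (Fin.castAdd N₂ i)) +
          spinOverlap (fun i => σ (Fin.natAdd N₁ i)) (fun i => τ (Fin.natAdd N₁ i)) := by
        simp only [spinOverlap, Fin.sum_univ_add]
      have := add_sq_div_add_le_add_sq_div
        (spinOverlap (fun i => σ (Fin.castAdd N₂ i)) fun i => τ (Fin.castAdd N₂ i))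
        (spinOverlap (fun i => σ (Fin.natAdd N₁ i)) fun i => τ (Fin.natAdd N₁ i)) hN₁ hN₂
      rw [hadd]
      linarith)
  rw [integral_partitionFn_skBlockCoeff] at hcmp
  have hp₁ := integral_partitionFn_rpow_pos (skCoeff N₁ β) (skField N₁ β h) hn
  have hp₂ := integral_partitionFn_rpow_pos (skCoeff N₂ β) (skField N₂ β h) hn
  rw [skPsi_eq, skPsi_eq, skPsi_eq, ← mul_add, ← Real.log_mul hp₁.ne' hp₂.ne']
  exact mul_le_mul_of_nonneg_left (Real.log_le_log (mul_pos hp₁ hp₂) hcmp)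
    (inv_nonneg.2 hn.1.le)

theorem skPhi_le {n β : ℝ} (h : ℝ) (hn : n ∈ Set.Ioc (0 : ℝ) 1) (hβ : 0 < β) (N : ℕ) :
    skPhi N n β h ≤ n⁻¹ * (2 + β * |h| + β ^ 2 / 4) := by
  have hn0 := hn.1
  rcases Nat.eq_zero_or_pos N with rfl | hN
  · rw [skPhi_eq, skPsi_zero, zero_div]
    positivity
  have hN' : (1 : ℝ) ≤ N := by exact_mod_cast hN
  rw [skPhi_eq, skPsi_eq, mul_div_assoc]
  refine mul_le_mul_of_nonneg_left ?_ (inv_nonneg.2 hn0.le)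
  rw [div_le_iff₀ (by linarith), Real.log_le_iff_le_exp (integral_partitionFn_rpow_pos _ _ hn)]
  refine (integral_partitionFn_rpow_le_one_add _ _ hn).trans ?_
  set K := β * |h| + β ^ 2 / 4 with hK
  have hK0 : 0 ≤ K := by positivity
  have hterm : ∀ σ : Fin N → Bool,
      rexp ((∑ k, skCoeff N β σ k ^ 2) / 2 + skField N β h σ) ≤ rexp (N * K) := by
    intro σ
    gcongr
    have h1 : ∑ k, skCoeff N β σ k ^ 2 = β ^ 2 / 2 * (N - 1) := by
      simp only [sq (skCoeff _ _ _ _)]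
      rw [sum_skCoeff_mul hN, spinOverlap_self]
      field_simp
    have h2 : skField N β h σ ≤ β * |h| * N := by
      refine (le_abs_self _).trans ?_
      rw [skField, abs_mul, abs_mul, abs_of_pos hβ]
      refine mul_le_mul_of_nonneg_left ((Finset.abs_sum_le_sum_abs _ _).trans ?_) (by positivity)
      simp [abs_spinVal]
    rw [h1, hK]
    nlinarith [sq_nonneg β]
  have h2 : (2 : ℝ) ≤ rexp 1 := by linarith [Real.add_one_le_exp (1 : ℝ)]
  have hcard : ∑ σ : Fin N → Bool, rexp ((∑ k, skCoeff N β σ k ^ 2) / 2 + skField N β h σ) ≤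
      rexp (N * (1 + K)) := by
    refine (Finset.sum_le_sum fun σ _ => hterm σ).trans ?_
    rw [Finset.sum_const, Finset.card_univ, nsmul_eq_mul, mul_add (N : ℝ) 1 K, Real.exp_add]
    gcongr
    rw [Real.exp_nat_mul]
    simp only [Fintype.card_fun, Fintype.card_bool, Fintype.card_fin, Nat.cast_pow, Nat.cast_ofNat]
    gcongr
  calc _ ≤ rexp (N * (1 + K)) + rexp (N * (1 + K)) :=
        add_le_add (Real.one_le_exp (by positivity)) hcard
    _ ≤ rexp 1 * rexp (N * (1 + K)) := by nlinarith [Real.exp_pos (N * (1 + K))]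
    _ ≤ _ := by
        rw [← Real.exp_add]
        gcongr
        rw [hK]
        linarith

/-- `N ↦ ψ_N(n,β,h)` is superadditive, and consequently
`lim_{N→∞} φ_N(n,β,h)` exists, is finite and equals `sup_{N≥1} φ_N(n,β,h)`. -/
theorem stmt5 (n β h : ℝ) (hn : n ∈ Set.Ioc (0:ℝ) 1) (hβ : 0 < β) :
    (∀ N₁ N₂ : ℕ, 1 ≤ N₁ → 1 ≤ N₂ →
      skPsi N₁ n β h + skPsi N₂ n β h ≤ skPsi (N₁ + N₂) n β h) ∧
    BddAbove (Set.range fun N : ℕ => skPhi (N + 1) n β h) ∧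
    Tendsto (fun N => skPhi N n β h) atTop (𝓝 (⨆ N : ℕ, skPhi (N + 1) n β h)) := by
  have hsup : ∀ N₁ N₂ : ℕ, 1 ≤ N₁ → 1 ≤ N₂ →
      skPsi N₁ n β h + skPsi N₂ n β h ≤ skPsi (N₁ + N₂) n β h :=
    fun N₁ N₂ h₁ h₂ => skPsi_add_le β h hn h₁ h₂
  have hbdd : BddAbove (Set.range fun N : ℕ => skPhi (N + 1) n β h) :=
    ⟨_, Set.forall_mem_range.2 fun N => skPhi_le h hn hβ (N + 1)⟩
  refine ⟨hsup, hbdd, ?_⟩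
  have hsub : Subadditive fun N => -skPsi N n β h := by
    intro p q
    rcases Nat.eq_zero_or_pos p with rfl | hp
    · simp [skPsi_zero]
    rcases Nat.eq_zero_or_pos q with rfl | hq
    · simp [skPsi_zero]
    linarith [hsup p q hp hq]
  have hdiv : ∀ N : ℕ, -skPsi N n β h / N = -skPhi N n β h := fun N => by
    rw [skPhi_eq, neg_div]
  have hbelow : BddBelow (Set.range fun N : ℕ => -skPsi N n β h / N) :=
    ⟨_, Set.forall_mem_range.2 fun N => by
      rw [hdiv]; exact neg_le_neg (skPhi_le h hn hβ N)⟩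
  have hlim : Tendsto (fun N => skPhi N n β h) atTop (𝓝 (-hsub.lim)) := by
    simpa [hdiv] using (hsub.tendsto_lim hbelow).neg
  have hle : ∀ N : ℕ, skPhi (N + 1) n β h ≤ -hsub.lim := fun N => by
    have := hsub.lim_le_div hbelow (Nat.succ_ne_zero N)
    rw [hdiv] at this
    linarith
  have heq : (⨆ N : ℕ, skPhi (N + 1) n β h) = -hsub.lim :=
    le_antisymm (ciSup_le hle)
      (le_of_tendsto' ((tendsto_add_atTop_iff_nat 1).2 hlim) fun N => le_ciSup hbdd N)
  rwa [heq]
end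
end

section
/- Let n ∈ (0,1] and β > 0 satisfy β²(1 + n) < 1 (i.e. β < β_c(n) = 1/√(1+n)). Define T : [0,1] → ℝ by T(q) = ( ∫_ℝ cosh^n(β√q z) tanh²(β√q z) dμ(z) ) / ( ∫_ℝ cosh^n(β√q z) dμ(z) ). Then q = 0 is the unique solution in [0,1] of the self-consistency equation q = T(q). -/
open MeasureTheory ProbabilityTheory Real Filter Topology

noncomputable section

/-- The `n`-deformed replica symmetric self-consistency map at zero external field:
`T(q) = (∫ cosh^n(β√q z) tanh²(β√q z) dμ(z)) / (∫ cosh^n(β√q z) dμ(z))`. -/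
def rsMap (n β q : ℝ) : ℝ :=
  (∫ z, Real.cosh (β * Real.sqrt q * z) ^ n * Real.tanh (β * Real.sqrt q * z) ^ 2
      ∂ gaussianReal 0 1) /
    (∫ z, Real.cosh (β * Real.sqrt q * z) ^ n ∂ gaussianReal 0 1)

/-- A weak form of `tanh x ≤ x` for `0 ≤ x` that is symmetric under `x ↦ -x`. -/
lemma tanh_sq_le_self_mul_tanh (x : ℝ) : tanh x ^ 2 ≤ x * tanh x := by
  have key : ∀ y : ℝ, 0 < y → tanh y ^ 2 ≤ y * tanh y := by
    intro y hy
    obtain ⟨c, hc, h⟩ := exists_hasDerivAt_eq_slope sinh cosh hy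
      continuous_sinh.continuousOn fun z _ ↦ hasDerivAt_sinh z
    have hcy : cosh c ≤ cosh y := by
      rw [cosh_le_cosh, abs_of_pos hc.1, abs_of_pos hy]
      exact hc.2.le
    have h2 : tanh y ≤ y := by
      rw [tanh_eq_sinh_div_cosh, div_le_iff₀ (cosh_pos y)]
      rw [sinh_zero, sub_zero, sub_zero, eq_div_iff hy.ne'] at h
      nlinarith
    have h3 : 0 ≤ tanh y := by
      rw [tanh_eq_sinh_div_cosh]
      exact div_nonneg (sinh_nonneg_iff.2 hy.le) (cosh_pos y).le
    nlinarith
  rcases lt_trichotomy x 0 with hx | rfl | hx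
  · simpa using key (-x) (neg_pos.2 hx)
  · simp
  · exact key x hx

lemma hasDerivAt_tanh (x : ℝ) : HasDerivAt tanh (1 - tanh x ^ 2) x := by
  have h := (hasDerivAt_sinh x).div (hasDerivAt_cosh x) (cosh_pos x).ne'
  have hfun : tanh = sinh / cosh := by
    ext y
    simp [tanh_eq_sinh_div_cosh]
  rw [hfun]
  convert! h using 1
  have := (cosh_pos x).ne'
  rw [Pi.div_apply]
  field_simp

lemma continuous_tanh : Continuous tanh :=
  continuous_iff_continuousAt.2 fun x ↦ (hasDerivAt_tanh x).continuousAt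

lemma hasDerivAt_gaussianPDFReal_zero_one (x : ℝ) :
    HasDerivAt (gaussianPDFReal 0 1) (-x * gaussianPDFReal 0 1 x) x := by
  have h : HasDerivAt (fun y : ℝ ↦ -(y - 0) ^ 2 / (2 * ((1 : NNReal) : ℝ))) (-x) x := by
    have := ((((hasDerivAt_id x).sub_const 0).pow 2).neg).div_const (2 * ((1 : NNReal) : ℝ))
    convert! this using 1
    simp
    ring
  rw [gaussianPDFReal_def]
  convert! h.exp.const_mul (√(2 * π * ((1 : NNReal) : ℝ)))⁻¹ using 1
  ring

lemma integrable_gaussianReal_zero_one_iff (f : ℝ → ℝ) :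
    Integrable f (gaussianReal 0 1) ↔ Integrable fun x ↦ f x * gaussianPDFReal 0 1 x := by
  rw [gaussianReal_of_var_ne_zero 0 one_ne_zero,
    integrable_withDensity_iff (measurable_gaussianPDF 0 1)
      (ae_of_all _ fun _ ↦ gaussianPDF_lt_top)]
  simp only [toReal_gaussianPDF]

/-- Gaussian integration by parts (Stein's identity). -/
lemma integral_self_mul_gaussianReal {g g' : ℝ → ℝ} (hg : ∀ x, HasDerivAt g (g' x) x)
    (hi : Integrable g (gaussianReal 0 1)) (hi' : Integrable g' (gaussianReal 0 1))
    (hx : Integrable (fun x ↦ x * g x) (gaussianReal 0 1)) :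
    ∫ x, x * g x ∂gaussianReal 0 1 = ∫ x, g' x ∂gaussianReal 0 1 := by
  have hd : ∀ x, HasDerivAt (fun y ↦ g y * gaussianPDFReal 0 1 y)
      ((g' x - x * g x) * gaussianPDFReal 0 1 x) x := by
    intro x
    convert! (hg x).mul (hasDerivAt_gaussianPDFReal_zero_one x) using 1
    ring
  have h0 := integral_eq_zero_of_hasDerivAt_of_integrable hd
    ((integrable_gaussianReal_zero_one_iff _).1 (hi'.sub hx))
    ((integrable_gaussianReal_zero_one_iff _).1 hi)
  have h1 : ∫ x, (g' x - x * g x) ∂gaussianReal 0 1 = 0 := by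
    rw [integral_gaussianReal_eq_integral_smul one_ne_zero]
    simpa only [smul_eq_mul, mul_comm] using h0
  rw [integral_sub hi' hx] at h1
  linarith

lemma integrable_pow_mul_cosh_gaussianReal (a : ℝ) (k : ℕ) :
    Integrable (fun z ↦ z ^ k * cosh (a * z)) (gaussianReal 0 1) := by
  have h (b : ℝ) : Integrable (fun z ↦ z ^ k * exp (b * z)) (gaussianReal 0 1) :=
    integrable_pow_mul_exp_of_integrable_exp_mul one_ne_zero
      (integrable_exp_mul_gaussianReal _) (integrable_exp_mul_gaussianReal _) k
  refine (((h a).add (h (-a))).div_const 2).congr (ae_of_all _ fun z ↦ ?_)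
  simp only [Pi.add_apply, cosh_eq, neg_mul]
  ring

lemma integrable_pow_mul_of_abs_le_cosh {g : ℝ → ℝ} (hg : Continuous g) {a : ℝ}
    (hb : ∀ z, |g z| ≤ cosh (a * z)) (k : ℕ) :
    Integrable (fun z ↦ z ^ k * g z) (gaussianReal 0 1) := by
  refine (integrable_pow_mul_cosh_gaussianReal a k).mono
    (by fun_prop) (ae_of_all _ fun z ↦ ?_)
  simp only [norm_mul, norm_eq_abs, abs_of_pos (cosh_pos (a * z))]
  exact mul_le_mul_of_nonneg_left (hb z) (abs_nonneg _)

/-- The deformed second moment of `tanh` is at most `a²` times the normalization. -/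
lemma integral_cosh_rpow_mul_tanh_sq_le {n : ℝ} (hn1 : n ≤ 1) (a : ℝ) :
    ∫ z, cosh (a * z) ^ n * tanh (a * z) ^ 2 ∂gaussianReal 0 1 ≤
      a ^ 2 * ∫ z, cosh (a * z) ^ n ∂gaussianReal 0 1 := by
  have hcont : Continuous fun z ↦ cosh (a * z) ^ n :=
    (continuous_cosh.comp (continuous_const_mul a)).rpow_const fun z ↦ Or.inl (cosh_pos _).ne'
  have htanh : Continuous fun z ↦ tanh (a * z) := continuous_tanh.comp (continuous_const_mul a)
  have hpos (z : ℝ) : 0 < cosh (a * z) ^ n := rpow_pos_of_pos (cosh_pos _) n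
  have hle (z : ℝ) : cosh (a * z) ^ n ≤ cosh (a * z) := by
    simpa using rpow_le_rpow_of_exponent_le (one_le_cosh (a * z)) hn1
  have hint (j k : ℕ) :
      Integrable (fun z ↦ z ^ k * (cosh (a * z) ^ n * tanh (a * z) ^ j)) (gaussianReal 0 1) := by
    refine integrable_pow_mul_of_abs_le_cosh (a := a) (hcont.mul (htanh.pow j)) (fun z ↦ ?_) k
    simp only [Pi.mul_apply, Pi.pow_apply]
    rw [abs_mul, abs_pow, abs_of_pos (hpos z)]
    exact (mul_le_of_le_one_right (hpos z).le
      (pow_le_one₀ (abs_nonneg _) (abs_tanh_lt_one _).le)).trans (hle z)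
  have hA : Integrable (fun z ↦ cosh (a * z) ^ n) (gaussianReal 0 1) := by
    simpa using hint 0 0
  have hB : Integrable (fun z ↦ cosh (a * z) ^ n * tanh (a * z) ^ 2) (gaussianReal 0 1) := by
    simpa using hint 2 0
  have hG : Integrable (fun z ↦ cosh (a * z) ^ n * tanh (a * z)) (gaussianReal 0 1) := by
    simpa using hint 1 0
  have hzG : Integrable (fun z ↦ z * (cosh (a * z) ^ n * tanh (a * z))) (gaussianReal 0 1) := by
    simpa using hint 1 1
  have hderiv (z : ℝ) : HasDerivAt (fun z ↦ cosh (a * z) ^ n * tanh (a * z))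
      (a * (cosh (a * z) ^ n - (1 - n) * (cosh (a * z) ^ n * tanh (a * z) ^ 2))) z := by
    have hlin : HasDerivAt (fun y ↦ a * y) a z := by
      simpa using (hasDerivAt_id z).const_mul a
    have hc : HasDerivAt (fun y ↦ cosh (a * y)) (sinh (a * z) * a) z :=
      (hasDerivAt_cosh (a * z)).comp z hlin
    have ht : HasDerivAt (fun y ↦ tanh (a * y)) ((1 - tanh (a * z) ^ 2) * a) z :=
      (hasDerivAt_tanh (a * z)).comp z hlin
    convert! (hc.rpow_const (p := n) (Or.inl (cosh_pos _).ne')).mul ht using 1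
    rw [rpow_sub_one (cosh_pos _).ne', tanh_eq_sinh_div_cosh]
    have := (cosh_pos (a * z)).ne'
    field_simp
    ring
  have hG' := (hA.sub (hB.const_mul (1 - n))).const_mul a
  have hstein := integral_self_mul_gaussianReal hderiv hG hG' hzG
  have hBnonneg : 0 ≤ ∫ z, cosh (a * z) ^ n * tanh (a * z) ^ 2 ∂gaussianReal 0 1 :=
    integral_nonneg fun z ↦ mul_nonneg (hpos z).le (sq_nonneg _)
  calc ∫ z, cosh (a * z) ^ n * tanh (a * z) ^ 2 ∂gaussianReal 0 1
      ≤ ∫ z, a * (z * (cosh (a * z) ^ n * tanh (a * z))) ∂gaussianReal 0 1 := by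
        refine integral_mono hB (hzG.const_mul a) fun z ↦ ?_
        have := mul_le_mul_of_nonneg_left (tanh_sq_le_self_mul_tanh (a * z)) (hpos z).le
        linarith
    _ = a ^ 2 * (∫ z, cosh (a * z) ^ n ∂gaussianReal 0 1 -
          (1 - n) * ∫ z, cosh (a * z) ^ n * tanh (a * z) ^ 2 ∂gaussianReal 0 1) := by
        rw [integral_const_mul, hstein, integral_const_mul,
          integral_sub hA (hB.const_mul (1 - n)), integral_const_mul]
        ring
    _ ≤ a ^ 2 * ∫ z, cosh (a * z) ^ n ∂gaussianReal 0 1 := by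
        gcongr
        exact sub_le_self _ (mul_nonneg (sub_nonneg.2 hn1) hBnonneg)

lemma rsMap_le {n β q : ℝ} (hn1 : n ≤ 1) (hq : 0 ≤ q) :
    rsMap n β q ≤ β ^ 2 * q := by
  have h := integral_cosh_rpow_mul_tanh_sq_le hn1 (β * √q)
  rw [mul_pow, sq_sqrt hq] at h
  exact div_le_of_le_mul₀ (integral_nonneg fun z ↦ (rpow_pos_of_pos (cosh_pos _) n).le)
    (by positivity) h

/-- if `β²(1+n) < 1` then `q = 0` is the unique solution in `[0,1]`
of the self-consistency equation `q = T(q)`. -/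
theorem stmt11 (n β : ℝ) (hn : n ∈ Set.Ioc (0:ℝ) 1) (hβ : 0 < β)
    (hc : β ^ 2 * (1 + n) < 1) :
    ∀ q ∈ Set.Icc (0:ℝ) 1, (q = rsMap n β q ↔ q = 0) := by
  rintro q ⟨hq, -⟩
  constructor
  · intro h
    have hle := rsMap_le (β := β) hn.2 hq
    rw [← h] at hle
    have hβ1 : β ^ 2 < 1 := by nlinarith [hn.1, sq_nonneg β]
    nlinarith
  · rintro rfl
    simp [rsMap]
end
end
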